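/- arXiv:1206.5523 — 2 statements merged into one kernel-verified Lean document; each statement's English description precedes it below -/
import Mathlib

section
/- For every self-adjoint bounded linear operator A on a separable complex Hilbert space H, there exists a conjugation J on H that commutes with A, i.e., J ∘ A = A ∘ J. -/
open ContinuousLinearMap

/-- A conjugation on a complex Hilbert space: a conjugate-linear, isometric involution. -/
def IsConjugation {H : Type*} [NormedAddCommGroup H] [InnerProductSpace ℂ H]
    (C : H → H) : Prop :=
  (∀ (a : ℂ) (x y : H), C (a • x + y) = (starRingEnd ℂ a) • C x + C y) ∧
  (∀ x, ‖C x‖ = ‖x‖) ∧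
  (∀ x, C (C x) = x)

/-- A reflexive symmetric relation has a clique that is equal to the set of all points related
to each of its members. -/
theorem exists_set_forall_mem_iff {α : Type*} (r : α → α → Prop) (hrefl : ∀ x, r x x)
    (hsymm : ∀ x y, r x y → r y x) : ∃ s : Set α, ∀ x, x ∈ s ↔ ∀ y ∈ s, r y x := by
  have hmax : IsMaxChain r (maxChain r) := maxChain_spec
  refine ⟨maxChain r, fun x => ⟨fun hx y hy => ?_, fun hx => ?_⟩⟩
  · by_cases hyx : y = x
    · exact hyx ▸ hrefl y
    · exact (hmax.1 hy hx hyx).elim id (hsymm x y)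
  · have hchain : IsChain r (insert x (maxChain r)) :=
      hmax.1.insert fun y hy _ => Or.inr (hx y hy)
    rw [hmax.2 hchain (Set.subset_insert _ _)]
    exact Set.mem_insert _ _

section InnerProductSpace

variable {H : Type*} [NormedAddCommGroup H] [InnerProductSpace ℂ H] [CompleteSpace H]

theorem IsSelfAdjoint.inner_pow_apply_right {A : H →L[ℂ] H} (hA : IsSelfAdjoint A) (n : ℕ)
    (x y : H) : inner ℂ x ((A ^ n) y) = inner ℂ ((A ^ n) x) y :=
  ((hA.pow n).isSymmetric x y).symm

/-- For a self-adjoint operator `A` there is a closed real subspace that is maximal among the sets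
whose elements have real inner products `⟪y, A ^ n x⟫`. -/
theorem IsSelfAdjoint.exists_real_submodule {A : H →L[ℂ] H} (hA : IsSelfAdjoint A) :
    ∃ S : Submodule ℝ H, IsClosed (S : Set H) ∧
      ∀ x, x ∈ S ↔ ∀ y ∈ S, ∀ n : ℕ, (inner ℂ y ((A ^ n) x)).im = 0 := by
  obtain ⟨s, hs⟩ := exists_set_forall_mem_iff
    (fun y x : H => ∀ n : ℕ, (inner ℂ y ((A ^ n) x)).im = 0)
    (fun x n => (hA.pow n).isSymmetric.im_inner_self_apply x)
    (fun x y h n => by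
      rw [hA.inner_pow_apply_right, ← inner_conj_symm, Complex.conj_im, h n, neg_zero])
  refine ⟨{ carrier := s, add_mem' := ?_, zero_mem' := ?_, smul_mem' := ?_ }, ?_, hs⟩
  · intro a b ha hb
    rw [hs] at ha hb ⊢
    intro y hy n
    rw [map_add, inner_add_right, Complex.add_im, ha y hy n, hb y hy n, add_zero]
  · rw [hs]
    simp
  · intro c x hx
    rw [hs] at hx ⊢
    intro y hy n
    rw [← Complex.coe_smul, map_smul, inner_smul_right, Complex.im_ofReal_mul, hx y hy n, mul_zero]
  · have hs_eq : s = ⋂ y ∈ s, ⋂ n : ℕ, {x | (inner ℂ y ((A ^ n) x)).im = 0} := by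
      ext x
      simpa using hs x
    change IsClosed s
    rw [hs_eq]
    refine isClosed_biInter fun y _ => isClosed_iInter fun n => isClosed_eq ?_ continuous_const
    exact Complex.continuous_im.comp (continuous_const.inner (A ^ n).continuous)

end InnerProductSpace

/-- Every self-adjoint operator on a separable complex Hilbert space commutes with
some conjugation. -/
theorem exists_conjugation_commuting_with_selfAdjoint
    {H : Type*} [NormedAddCommGroup H] [InnerProductSpace ℂ H] [CompleteSpace H]
    [TopologicalSpace.SeparableSpace H]
    (A : H →L[ℂ] H) (hA : IsSelfAdjoint A) :
    ∃ J : H → H, IsConjugation J ∧ ∀ x, J (A x) = A (J x) := by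
  obtain ⟨S, hS_closed, hS⟩ := hA.exists_real_submodule
  let _ : InnerProductSpace ℝ H := InnerProductSpace.complexToReal
  have : CompleteSpace S := hS_closed.completeSpace_coe
  have hinner (x y : H) : inner ℝ x y = (inner ℂ x y).re := rfl
  have hA_mem (x : H) (hx : x ∈ S) : A x ∈ S := by
    rw [hS] at hx ⊢
    intro y hy n
    simpa [pow_succ] using hx y hy (n + 1)
  have hpow_mem (n : ℕ) (x : H) (hx : x ∈ S) : (A ^ n) x ∈ S := by
    induction n with
    | zero => simpa using hx
    | succ n ih => simpa [pow_succ'] using hA_mem _ ih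
  have hI_mem (x : H) (hx : x ∈ S) : Complex.I • x ∈ Sᗮ := by
    rw [Submodule.mem_orthogonal]
    intro y hy
    have him : (inner ℂ y x).im = 0 := by simpa using (hS x).1 hx y hy 0
    simp [hinner, him]
  have hdecomp (h : H) : ∃ x ∈ S, ∃ y ∈ S, h = x + Complex.I • y := by
    obtain ⟨x, hx, r, hr, rfl⟩ := S.exists_add_mem_mem_orthogonal h
    refine ⟨x, hx, -(Complex.I • r), (hS _).2 fun y hy n => ?_, by simp [smul_smul]⟩
    have hre := (Submodule.mem_orthogonal S r).1 hr _ (hpow_mem n y hy)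
    rw [hinner] at hre
    rw [hA.inner_pow_apply_right]
    rw [inner_neg_right, inner_smul_right, Complex.neg_im, Complex.I_mul_im, hre, neg_zero]
  have hJ (x y : H) (hx : x ∈ S) (hy : y ∈ S) :
      S.reflection (x + Complex.I • y) = x - Complex.I • y := by
    rw [map_add, Submodule.reflection_mem_subspace_eq_self hx,
      Submodule.reflection_mem_subspace_orthogonalComplement_eq_neg (hI_mem y hy), sub_eq_add_neg]
  have hJ_I (h : H) : S.reflection (Complex.I • h) = -(Complex.I • S.reflection h) := by
    obtain ⟨x, hx, y, hy, rfl⟩ := hdecomp h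
    have hIh : Complex.I • (x + Complex.I • y) = -y + Complex.I • x := by
      simp [smul_add, smul_smul, add_comm]
    rw [hIh, hJ _ _ (S.neg_mem hy) hx, hJ _ _ hx hy]
    simp [smul_smul, sub_eq_add_neg, add_comm]
  have hJ_smul (a : ℂ) (h : H) :
      S.reflection (a • h) = starRingEnd ℂ a • S.reflection h := by
    have hsmul (b : ℂ) (k : H) : b • k = b.re • k + b.im • Complex.I • k := by
      conv_lhs => rw [← Complex.re_add_im b]
      rw [add_smul, mul_smul, Complex.coe_smul, Complex.coe_smul]
    rw [hsmul a, hsmul (starRingEnd ℂ a), map_add, map_smul, map_smul, hJ_I]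
    simp
  refine ⟨S.reflection, ⟨fun a x y => by rw [map_add, hJ_smul],
    S.reflection.norm_map, S.reflection_reflection⟩, fun h => ?_⟩
  obtain ⟨x, hx, y, hy, rfl⟩ := hdecomp h
  rw [hJ x y hx hy, map_add, map_smul, hJ _ _ (hA_mem x hx) (hA_mem y hy), map_sub, map_smul]
end

section
/- Let A be an n × n complex matrix. Then A² = 0 if and only if A is indestructible, i.e., for every m ≥ 1 and every m × m complex matrix B, the Kronecker product A ⊗ B is unitarily similar to a symmetric complex matrix. -/
open Matrix Kronecker

open scoped InnerProductSpace ComplexOrder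

/-- A square-zero operator has a symmetric matrix with respect to some orthonormal basis. -/
theorem exists_orthonormalBasis_inner_symm {E : Type*} [NormedAddCommGroup E]
    [InnerProductSpace ℂ E] [FiniteDimensional ℂ E] (T : E →ₗ[ℂ] E) (hT : ∀ x, T (T x) = 0)
    {ι : Type*} [Fintype ι] (hι : Module.finrank ℂ E = Fintype.card ι) :
    ∃ b : OrthonormalBasis ι ℂ E, ∀ j k, ⟪b j, T (b k)⟫_ℂ = ⟪b k, T (b j)⟫_ℂ := by
  classical
  have hS : (LinearMap.adjoint T * T).IsSymmetric := LinearMap.isSymmetric_adjoint_mul_self T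
  let v := hS.eigenvectorBasis rfl
  have hv : ∀ i x, ⟪T (v i), T x⟫_ℂ = (hS.eigenvalues rfl i : ℂ) * ⟪v i, x⟫_ℂ := by
    intro i x
    rw [← LinearMap.adjoint_inner_left]
    have h := hS.apply_eigenvectorBasis rfl i
    rw [Module.End.mul_apply] at h
    rw [h, inner_smul_left]
    simp [v]
  let J := {i // T (v i) ≠ 0}
  obtain ⟨u, hu⟩ : ∃ u : J → E, ∀ i, u i = ((‖T (v i)‖ : ℂ)⁻¹) • T (v i) := ⟨_, fun _ => rfl⟩
  have hn : ∀ i : J, (‖T (v i)‖ : ℂ) ≠ 0 := fun i => by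
    simpa using i.2
  have hTv : ∀ i : J, T (v i) = (‖T (v i)‖ : ℂ) • u i := fun i => by
    simp only [hu, smul_smul, mul_inv_cancel₀ (hn i), one_smul]
  have hlam : ∀ i, (hS.eigenvalues rfl i : ℂ) = (‖T (v i)‖ : ℂ) ^ 2 := by
    intro i
    have h := hv i (v i)
    rw [inner_self_eq_norm_sq_to_K, inner_self_eq_norm_sq_to_K, v.norm_eq_one] at h
    simpa using h.symm
  have hvv : ∀ i j : J, ⟪v i, v j⟫_ℂ = if i = j then 1 else 0 := fun i j => by
    rw [orthonormal_iff_ite.mp v.orthonormal]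
    exact if_congr Subtype.ext_iff.symm rfl rfl
  have huu : ∀ i j : J, ⟪u i, u j⟫_ℂ = if i = j then 1 else 0 := fun i j => by
    simp only [hu, inner_smul_left, inner_smul_right, hv, hlam, hvv]
    split_ifs with h
    · subst h
      have := hn i
      simp
      field_simp
    · simp
  have hvu : ∀ i j : J, ⟪v i, u j⟫_ℂ = 0 := fun i j => by
    have h := hv i (u j)
    have h0 : T (u j) = 0 := by simp [hu, hT]
    rw [h0, inner_zero_right, hlam] at h
    exact (mul_eq_zero.mp h.symm).resolve_left (pow_ne_zero _ (hn i))
  have huv : ∀ i j : J, ⟪u i, v j⟫_ℂ = 0 := fun i j => by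
    rw [← inner_conj_symm, hvu, map_zero]
  obtain ⟨c, hc, hcc⟩ : ∃ c : ℂ, c * c = 1 / 2 ∧ (starRingEnd ℂ) c = c := by
    refine ⟨((√2 : ℝ) : ℂ)⁻¹, ?_, by simp⟩
    simp only [← mul_inv, ← Complex.ofReal_mul]
    norm_num
  have hc0 : c ≠ 0 := by
    rintro rfl
    norm_num at hc
  let g : J ⊕ J → E :=
    Sum.elim (fun i => c • (u i + v i)) (fun i => (c * Complex.I) • (u i - v i))
  have hg : Orthonormal ℂ g := by
    rw [orthonormal_iff_ite]
    rintro (i | i) (j | j) <;>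
    · simp only [g, Sum.elim_inl, Sum.elim_inr, inner_smul_left, inner_smul_right, inner_add_left,
        inner_add_right, inner_sub_left, inner_sub_right, hvv, huu, hvu, huv, map_mul, hcc,
        Complex.conj_I, Sum.inl.injEq, Sum.inr.injEq, reduceCtorEq, if_false]
      split_ifs <;> first
        | ring1
        | linear_combination (2 : ℂ) * hc
        | linear_combination (2 : ℂ) * hc - 2 * c * c * Complex.I_sq
  obtain ⟨t, b, hgt, hb⟩ := hg.toSubtypeRange.exists_orthonormalBasis_extension
  have hreal : ∀ (k : t) (i : J), ⟪v i, b k⟫_ℂ = ⟪b k, u i⟫_ℂ := by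
    intro k i
    by_cases hk : (k : E) ∈ Set.range g
    · obtain ⟨j, hj⟩ := hk
      rw [hb, ← hj]
      rcases j with j | j
      · simp only [g, Sum.elim_inl, inner_smul_left, inner_smul_right, inner_add_left,
          inner_add_right, hvv, huu, hvu, hcc, eq_comm (a := j), zero_add, add_zero]
      · simp only [g, Sum.elim_inr, inner_smul_left, inner_smul_right, inner_sub_left,
          inner_sub_right, hvv, huu, hvu, map_mul, hcc, Complex.conj_I, eq_comm (a := j)]
        ring
    · have horth : ∀ j, ⟪b k, g j⟫_ℂ = 0 := by
        intro j
        have hj : g j = b ⟨g j, hgt ⟨j, rfl⟩⟩ := by rw [hb]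
        rw [hj]
        refine b.orthonormal.2 fun h => hk ⟨j, ?_⟩
        rw [h]
      have h1 : ⟪b k, u i⟫_ℂ + ⟪b k, v i⟫_ℂ = 0 := by
        simpa [g, inner_smul_right, inner_add_right, ← mul_add, hc0] using horth (Sum.inl i)
      have h2 : ⟪b k, u i⟫_ℂ - ⟪b k, v i⟫_ℂ = 0 := by
        simpa [g, inner_smul_right, inner_sub_right, ← mul_sub, hc0] using horth (Sum.inr i)
      have h3 : ⟪b k, v i⟫_ℂ = 0 := by linear_combination (h1 - h2) / 2
      have h4 : ⟪b k, u i⟫_ℂ = 0 := by linear_combination (h1 + h2) / 2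
      rw [h4, ← inner_conj_symm, h3, map_zero]
  have hsymm : ∀ j k : t, ⟪b j, T (b k)⟫_ℂ = ⟪b k, T (b j)⟫_ℂ := by
    have hexp : ∀ j k : t, ⟪b j, T (b k)⟫_ℂ = ∑ i, ⟪v i, b k⟫_ℂ * ⟪b j, T (v i)⟫_ℂ := by
      intro j k
      conv_lhs => rw [← v.sum_repr' (b k)]
      simp only [map_sum, map_smul, inner_sum, inner_smul_right]
    intro j k
    rw [hexp, hexp]
    refine Finset.sum_congr rfl fun i _ => ?_
    by_cases hi : T (v i) = 0
    · simp [hi]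
    · have h1 := hreal k ⟨i, hi⟩
      have h2 := hreal j ⟨i, hi⟩
      have h3 := hTv ⟨i, hi⟩
      simp only at h1 h2 h3
      rw [h1, h2, h3, inner_smul_right, inner_smul_right]
      ring
  have hcard : Fintype.card t = Fintype.card ι := by
    rw [← hι, Module.finrank_eq_card_basis b.toBasis]
  let e := Fintype.equivOfCardEq hcard
  exact ⟨b.reindex e, fun j k => by simpa using hsymm (e.symm j) (e.symm k)⟩

/-- A square-zero complex matrix is unitarily similar to a symmetric matrix. -/
theorem Matrix.exists_unitary_conj_transpose_eq_of_sq_zero {ι : Type*} [Fintype ι] [DecidableEq ι]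
    (T : Matrix ι ι ℂ) (hT : T * T = 0) :
    ∃ W ∈ Matrix.unitaryGroup ι ℂ, (W * T * star W)ᵀ = W * T * star W := by
  obtain ⟨b, hb⟩ := exists_orthonormalBasis_inner_symm (Matrix.toEuclideanLin T)
    (fun x => by
      ext i
      simp [Matrix.toLpLin_apply, Matrix.mulVec_mulVec, hT]) (ι := ι) (by simp)
  let W : Matrix ι ι ℂ := .of fun i j => star (b i j)
  have hinner : ∀ x y : EuclideanSpace ℂ ι, ⟪x, y⟫_ℂ = ∑ a, star (x a) * y a := fun x y => by
    simp [PiLp.inner_apply, mul_comm]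
  have hW : ∀ j k, (W * T * star W) j k = ⟪b j, Matrix.toEuclideanLin T (b k)⟫_ℂ := by
    intro j k
    rw [hinner, Matrix.mul_assoc, Matrix.mul_apply]
    simp [W, Matrix.mul_apply, Matrix.toLpLin_apply, Matrix.mulVec, dotProduct, Matrix.star_apply]
  refine ⟨W, ?_, ?_⟩
  · rw [Matrix.mem_unitaryGroup_iff]
    ext j k
    have h := orthonormal_iff_ite.mp b.orthonormal j k
    rw [hinner] at h
    rw [Matrix.mul_apply, Matrix.one_apply, ← h]
    simp [W, Matrix.star_apply]
  · ext j k
    rw [Matrix.transpose_apply, hW, hW, hb]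

/-- The squared Frobenius norms of `S² S*` and `S* S²` agree when `S` is symmetric. -/
theorem Matrix.IsSymm.trace_eq {ι : Type*} [Fintype ι] {S : Matrix ι ι ℂ} (hS : S.IsSymm) :
    (S * S * Sᴴ * (S * S * Sᴴ)ᴴ).trace = (Sᴴ * S * S * (Sᴴ * S * S)ᴴ).trace := by
  have hSH : Sᴴᵀ = Sᴴ := hS.conjTranspose
  rw [← Matrix.trace_transpose, Matrix.transpose_mul, Matrix.trace_mul_comm]
  simp only [Matrix.transpose_mul, Matrix.conjTranspose_mul, Matrix.conjTranspose_conjTranspose,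
    hS.eq, hSH, Matrix.mul_assoc]

/-- The squared Frobenius norms of `T² T*` and `T* T²` agree when `T` is unitarily similar to a
symmetric matrix. -/
theorem Matrix.trace_eq_of_unitary_conj_transpose_eq {ι : Type*} [Fintype ι] [DecidableEq ι]
    {T W : Matrix ι ι ℂ} (hW : W ∈ Matrix.unitaryGroup ι ℂ)
    (h : (W * T * star W)ᵀ = W * T * star W) :
    (T * T * Tᴴ * (T * T * Tᴴ)ᴴ).trace = (Tᴴ * T * T * (Tᴴ * T * T)ᴴ).trace := by
  have hWW : Wᴴ * W = 1 := Matrix.mem_unitaryGroup_iff'.mp hW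
  have hcancel : ∀ X : Matrix ι ι ℂ, Wᴴ * (W * X) = X := fun X => by
    rw [← Matrix.mul_assoc, hWW, Matrix.one_mul]
  have htr : ∀ X : Matrix ι ι ℂ, (W * X * Wᴴ).trace = X.trace := fun X => by
    rw [Matrix.trace_mul_comm, hcancel]
  have key := Matrix.IsSymm.trace_eq h
  rw [← htr (_ * _), ← htr (Tᴴ * T * T * _)]
  simpa only [Matrix.star_eq_conjTranspose, Matrix.conjTranspose_mul,
    Matrix.conjTranspose_conjTranspose, Matrix.mul_assoc, hcancel] using key

/-- An `n × n` complex matrix `A` satisfies `A² = 0` if and only if it is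
*indestructible*: for every `m ≥ 1` and every `m × m` complex matrix `B`, the Kronecker
product `A ⊗ₖ B` is unitarily similar to a symmetric complex matrix. -/
theorem sq_zero_iff_indestructible
    {n : ℕ} (A : Matrix (Fin n) (Fin n) ℂ) :
    A * A = 0 ↔
      ∀ (m : ℕ), 1 ≤ m → ∀ B : Matrix (Fin m) (Fin m) ℂ,
        ∃ W ∈ Matrix.unitaryGroup (Fin n × Fin m) ℂ,
          (W * (A ⊗ₖ B) * star W)ᵀ = W * (A ⊗ₖ B) * star W := by
  constructor
  · intro hA m _ B
    exact Matrix.exists_unitary_conj_transpose_eq_of_sq_zero _ (by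
      rw [← Matrix.mul_kronecker_mul, hA, Matrix.zero_kronecker])
  · intro h
    have key : ∀ m, 1 ≤ m → ∀ B : Matrix (Fin m) (Fin m) ℂ,
        (A * A * Aᴴ * (A * A * Aᴴ)ᴴ).trace * (B * B * Bᴴ * (B * B * Bᴴ)ᴴ).trace =
          (Aᴴ * A * A * (Aᴴ * A * A)ᴴ).trace * (Bᴴ * B * B * (Bᴴ * B * B)ᴴ).trace := by
      intro m hm B
      obtain ⟨W, hW, hs⟩ := h m hm B
      have := Matrix.trace_eq_of_unitary_conj_transpose_eq hW hs
      simpa only [Matrix.conjTranspose_kronecker, ← Matrix.mul_kronecker_mul,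
        Matrix.trace_kronecker] using this
    have h1 := key 1 le_rfl 1
    have h3 := key 3 (by norm_num) !![0, 1, 0; 0, 0, 2; 0, 0, 0]
    have hconj : (!![0, 1, 0; 0, 0, 2; 0, 0, 0] : Matrix (Fin 3) (Fin 3) ℂ)ᴴ =
        !![0, 0, 0; 1, 0, 0; 0, 2, 0] := by
      ext i j
      fin_cases i <;> fin_cases j <;> simp [Matrix.conjTranspose_apply]
    have hconj' := congrArg Matrix.conjTranspose hconj.symm
    rw [Matrix.conjTranspose_conjTranspose] at hconj'
    have h0 : (A * A * Aᴴ * (A * A * Aᴴ)ᴴ).trace = 0 := by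
      generalize (A * A * Aᴴ * (A * A * Aᴴ)ᴴ).trace = p at h1 h3 ⊢
      generalize (Aᴴ * A * A * (Aᴴ * A * A)ᴴ).trace = q at h1 h3
      simp only [Matrix.conjTranspose_mul, hconj, hconj'] at h3
      simp at h1
      simp [Matrix.trace_fin_three] at h3
      norm_num at h3
      linear_combination h3 / 12 - h1 / 3
    rw [Matrix.trace_mul_conjTranspose_self_eq_zero_iff] at h0
    rw [← Matrix.self_mul_conjTranspose_eq_zero, Matrix.conjTranspose_mul, ← Matrix.mul_assoc, h0,
      Matrix.zero_mul]
end
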